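/- Suppose ≿ has an ECU representation with threshold d. Let α ∈ [0,1] and let p be a simple lottery with p([w,d]) = α. Suppose for each x ∈ supp p a value φ_x ∈ [0,1] is given satisfying: if x ≤ d and α > 0, then αδ_x+(1-α)δ_b ∼ αφ_xδ_b+α(1-φ_x)δ_w+(1-α)δ_b; if x > d and α < 1, then αδ_w+(1-α)δ_x ∼ αδ_w+(1-α)φ_xδ_b+(1-α)(1-φ_x)δ_w; and if d = b and α = 1, then δ_x ∼ φ_xδ_b+(1-φ_x)δ_w. Then p ∼ ∑_{x ∈ supp p} p(x)·[φ_xδ_b + (1-φ_x)δ_w]. -/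

import Mathlib

open Set

noncomputable section

/-- The Dirac lottery `δ_x` at a prize `x`. -/
def delta (x : ℝ) : ℝ → ℝ := fun y => if y = x then 1 else 0

/-- `p` is a simple lottery on the prize space `X = [w, b]`: a finitely supported
function into `[0,1]` vanishing outside `[w,b]` and summing to `1`. -/
def IsLottery (w b : ℝ) (p : ℝ → ℝ) : Prop :=
  (Function.support p).Finite ∧ (∀ x, 0 ≤ p x ∧ p x ≤ 1) ∧
    (∀ x, x ∉ Icc w b → p x = 0) ∧ (∑ᶠ x, p x) = 1

/-- The probability `p(S)` that a lottery assigns to a set of prizes. -/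
def prob (p : ℝ → ℝ) (S : Set ℝ) : ℝ := ∑ᶠ x ∈ S, p x

/-- Indifference: the symmetric part `∼` of `≿`. -/
def Indiff (R : (ℝ → ℝ) → (ℝ → ℝ) → Prop) (p q : ℝ → ℝ) : Prop := R p q ∧ R q p

/-- Strict preference: the asymmetric part `≻` of `≿`. -/
def StrictPref (R : (ℝ → ℝ) → (ℝ → ℝ) → Prop) (p q : ℝ → ℝ) : Prop := R p q ∧ ¬ R q p

/-- Axiom 1 (first half): `≿` is complete on simple lotteries. -/
def CompleteAx (w b : ℝ) (R : (ℝ → ℝ) → (ℝ → ℝ) → Prop) : Prop :=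
  ∀ p q, IsLottery w b p → IsLottery w b q → R p q ∨ R q p

/-- Axiom 1 (second half): `≿` is transitive on simple lotteries. -/
def TransitiveAx (w b : ℝ) (R : (ℝ → ℝ) → (ℝ → ℝ) → Prop) : Prop :=
  ∀ p q r, IsLottery w b p → IsLottery w b q → IsLottery w b r → R p q → R q r → R p r

/-- Axiom 2 (Monotonicity). -/
def MonotonicityAx (w b : ℝ) (R : (ℝ → ℝ) → (ℝ → ℝ) → Prop) : Prop :=
  ∀ t₁ ∈ Icc (0:ℝ) 1, ∀ t₂ ∈ Icc (0:ℝ) 1,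
    (R (t₁ • delta b + (1 - t₁) • delta w) (t₂ • delta b + (1 - t₂) • delta w) ↔ t₂ ≤ t₁)

/-- Axiom 3 (Replacement Monotonicity). -/
def ReplacementMonotonicityAx (w b : ℝ) (R : (ℝ → ℝ) → (ℝ → ℝ) → Prop) : Prop :=
  ∀ x ∈ Icc w b, ∀ α ∈ Icc (0:ℝ) 1,
    R (α • delta b + (1 - α) • delta x) (α • delta b + (1 - α) • delta w) ∧
    R (α • delta b + (1 - α) • delta w) (α • delta x + (1 - α) • delta w)

/-- Axiom 4 (Weak Solvability). -/
def WeakSolvabilityAx (w b : ℝ) (R : (ℝ → ℝ) → (ℝ → ℝ) → Prop) : Prop :=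
  ∀ p, IsLottery w b p → ∃ γ ∈ Icc (0:ℝ) 1, Indiff R p (γ • delta b + (1 - γ) • delta w)

/-- A family `u π` of utility functions, indexed by the disappointment probability
`π ∈ [0,1]`, is contextual for the threshold `d`. -/
def Contextual (w b d : ℝ) (u : ℝ → ℝ → ℝ) : Prop :=
  (∀ π ∈ Icc (0:ℝ) 1, ∀ μ ∈ Icc (0:ℝ) 1, u π w = u μ w ∧ u π b = u μ b) ∧
  (∀ π ∈ Icc (0:ℝ) 1, u π w < u π b) ∧
  (∀ π ∈ Icc (0:ℝ) 1, ∀ x ∈ Ioo w b, u π x ∈ Icc (u π w) (u π b)) ∧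
  (d ≠ b → ∀ x ∈ Ioo w b, ∃ π ∈ Ioo (0:ℝ) 1, ∃ μ ∈ Ioo (0:ℝ) 1, u π x ≠ u μ x)

/-- The ECU value of a lottery `p`: `V(p) = ∑ₓ p(x) · u_π(x)` where `π = p([w,d])`. -/
def ECUval (w b d : ℝ) (u : ℝ → ℝ → ℝ) (p : ℝ → ℝ) : ℝ :=
  ∑ᶠ x, p x * u (prob p (Icc w d)) x

/-- `(d, u)` is an expected contextual utility (ECU) representation of `≿`. -/
def IsECU (w b : ℝ) (R : (ℝ → ℝ) → (ℝ → ℝ) → Prop) (d : ℝ) (u : ℝ → ℝ → ℝ) : Prop :=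
  d ∈ Icc w b ∧ Contextual w b d u ∧
    ∀ p q, IsLottery w b p → IsLottery w b q →
      (R p q ↔ ECUval w b d u q ≤ ECUval w b d u p)

/-- `φ` assigns to each prize `x` the value `φ_x ∈ [0,1]` with `δ_x ∼ φ_x δ_b + (1-φ_x) δ_w`. -/
def IsPhi (w b : ℝ) (R : (ℝ → ℝ) → (ℝ → ℝ) → Prop) (φ : ℝ → ℝ) : Prop :=
  ∀ x ∈ Icc w b, φ x ∈ Icc (0:ℝ) 1 ∧
    Indiff R (delta x) (φ x • delta b + (1 - φ x) • delta w)

/-- The set `𝒟` defined from the preference relation via the values `φ_x`. -/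
def Dset (w b : ℝ) (R : (ℝ → ℝ) → (ℝ → ℝ) → Prop) (φ : ℝ → ℝ) : Set ℝ :=
  { x | x ∈ Ico w b ∧ ∀ α ∈ Icc (0:ℝ) 1,
      Indiff R (α • delta x + (1 - α) • delta w)
        ((α * φ x) • delta b + (α * (1 - φ x)) • delta w + (1 - α) • delta w) }

lemma support_mix_subset (a b c x y z : ℝ) :
    Function.support (a • delta x + b • delta y + c • delta z) ⊆ (({x, y, z} : Finset ℝ) : Set ℝ) := by
  intro t ht
  by_contra h
  simp only [Finset.coe_insert, Finset.coe_singleton, mem_insert_iff, mem_singleton_iff,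
    not_or] at h
  exact ht (by simp [delta, h])

lemma finsum_delta_mul (x : ℝ) (f : ℝ → ℝ) : ∑ᶠ t, delta x t * f t = f x := by
  rw [finsum_eq_single _ x fun t ht => by simp [delta, ht]]
  simp [delta]

lemma finite_support_smul_delta_mul (a x : ℝ) (f : ℝ → ℝ) :
    (Function.support fun t => a * (delta x t * f t)).Finite :=
  (finite_singleton x).subset fun t ht => by
    by_contra h
    exact ht (by simp [delta, show t ≠ x from h])

/-- Expectation of `f` under a mixture of three Dirac lotteries. -/
lemma finsum_mix_mul (a b c x y z : ℝ) (f : ℝ → ℝ) :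
    ∑ᶠ t, (a • delta x + b • delta y + c • delta z) t * f t = a * f x + b * f y + c * f z := by
  have h : ∀ t, (a • delta x + b • delta y + c • delta z) t * f t =
      a * (delta x t * f t) + b * (delta y t * f t) + c * (delta z t * f t) := by
    intro t
    simp only [Pi.add_apply, Pi.smul_apply, smul_eq_mul]
    ring
  have hx := finite_support_smul_delta_mul a x f
  have hy := finite_support_smul_delta_mul b y f
  have hz := finite_support_smul_delta_mul c z f
  simp only [h]
  rw [finsum_add_distrib ((hx.union hy).subset (Function.support_add _ _)) hz,
    finsum_add_distrib hx hy, ← mul_finsum, ← mul_finsum, ← mul_finsum,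
    finsum_delta_mul, finsum_delta_mul, finsum_delta_mul]

lemma prob_eq_finsum_mul_indicator (p : ℝ → ℝ) (S : Set ℝ) :
    prob p S = ∑ᶠ x, p x * S.indicator 1 x := by
  unfold prob
  rw [finsum_mem_def]
  refine finsum_congr fun x => ?_
  by_cases h : x ∈ S <;> simp [h]

lemma isLottery_mix {w b : ℝ} {a₁ a₂ a₃ x y z : ℝ} (h₁ : 0 ≤ a₁) (h₂ : 0 ≤ a₂) (h₃ : 0 ≤ a₃)
    (hsum : a₁ + a₂ + a₃ = 1) (hx : x ∈ Icc w b) (hy : y ∈ Icc w b) (hz : z ∈ Icc w b) :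
    IsLottery w b (a₁ • delta x + a₂ • delta y + a₃ • delta z) := by
  refine ⟨(Finset.finite_toSet _).subset (support_mix_subset a₁ a₂ a₃ x y z), fun t => ?_,
    fun t ht => ?_, ?_⟩
  · simp only [Pi.add_apply, Pi.smul_apply, smul_eq_mul, delta]
    constructor <;> split_ifs <;> linarith
  · have hne : t ≠ x ∧ t ≠ y ∧ t ≠ z :=
      ⟨fun h => ht (h ▸ hx), fun h => ht (h ▸ hy), fun h => ht (h ▸ hz)⟩
    simp [delta, hne]
  · simpa [hsum] using finsum_mix_mul a₁ a₂ a₃ x y z 1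

lemma ECUval_mix {w b d : ℝ} (u : ℝ → ℝ → ℝ) {a₁ a₂ a₃ x y z π : ℝ}
    (hπ : a₁ * (Icc w d).indicator 1 x + a₂ * (Icc w d).indicator 1 y
      + a₃ * (Icc w d).indicator 1 z = π) :
    ECUval w b d u (a₁ • delta x + a₂ • delta y + a₃ • delta z) =
      a₁ * u π x + a₂ * u π y + a₃ * u π z := by
  rw [ECUval, prob_eq_finsum_mul_indicator, finsum_mix_mul _ _ _ _ _ _ ((Icc w d).indicator 1), hπ,
    finsum_mix_mul]

lemma prob_mem_Icc {w b : ℝ} {p : ℝ → ℝ} (hp : IsLottery w b p) (S : Set ℝ) :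
    prob p S ∈ Icc (0 : ℝ) 1 := by
  obtain ⟨hfin, h01, -, hsum⟩ := hp
  rw [finsum_eq_sum_of_support_subset p (s := hfin.toFinset) (by simp)] at hsum
  have hprob : prob p S = ∑ x ∈ hfin.toFinset, p x * S.indicator 1 x := by
    rw [prob_eq_finsum_mul_indicator]
    refine finsum_eq_sum_of_support_subset _ ?_
    simp
  have hind : ∀ x, 0 ≤ S.indicator (1 : ℝ → ℝ) x ∧ S.indicator (1 : ℝ → ℝ) x ≤ 1 := by
    intro x
    by_cases h : x ∈ S <;> simp [h]
  rw [hprob]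
  refine ⟨Finset.sum_nonneg fun x _ => mul_nonneg (h01 x).1 (hind x).1, ?_⟩
  rw [← hsum]
  exact Finset.sum_le_sum fun x _ => mul_le_of_le_one_right (h01 x).1 (hind x).2

lemma le_prob {w b : ℝ} {p : ℝ → ℝ} (hp : IsLottery w b p) {S : Set ℝ} {x : ℝ} (hx : x ∈ S) :
    p x ≤ prob p S := by
  obtain ⟨hfin, h01, -, -⟩ := hp
  have := single_le_finsum (f := fun t => p t * S.indicator 1 t) x
    (hfin.subset (Function.support_mul_subset_left p _))
    fun t => mul_nonneg (h01 t).1 (indicator_nonneg (fun _ _ => zero_le_one) t)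
  simpa [prob_eq_finsum_mul_indicator, hx] using this

lemma prob_add_prob_compl {w b : ℝ} {p : ℝ → ℝ} (hp : IsLottery w b p) (S : Set ℝ) :
    prob p S + prob p Sᶜ = 1 := by
  have hfin := hp.1
  rw [prob_eq_finsum_mul_indicator, prob_eq_finsum_mul_indicator, ← finsum_add_distrib
    (hfin.subset (Function.support_mul_subset_left p _))
    (hfin.subset (Function.support_mul_subset_left p _)), ← hp.2.2.2]
  refine finsum_congr fun x => ?_
  by_cases h : x ∈ S <;> simp [h]

lemma prob_eq_one {w b : ℝ} {p : ℝ → ℝ} (hp : IsLottery w b p) {S : Set ℝ}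
    (hS : Icc w b ⊆ S) : prob p S = 1 := by
  have h0 : prob p Sᶜ = 0 := by
    rw [prob_eq_finsum_mul_indicator, ← finsum_zero (α := ℝ)]
    refine finsum_congr fun x => ?_
    by_cases h : x ∈ S
    · simp [h]
    · simp [hp.2.2.1 x fun hx => h (hS hx)]
  linarith [prob_add_prob_compl hp S]

lemma IsECU.ECUval_eq {w b : ℝ} {R : (ℝ → ℝ) → (ℝ → ℝ) → Prop} {d : ℝ} {u : ℝ → ℝ → ℝ}
    (h : IsECU w b R d u) {p q : ℝ → ℝ} (hp : IsLottery w b p) (hq : IsLottery w b q)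
    (hpq : Indiff R p q) : ECUval w b d u p = ECUval w b d u q :=
  le_antisymm ((h.2.2 q p hq hp).1 hpq.2) ((h.2.2 p q hp hq).1 hpq.1)

lemma IsECU.indiff {w b : ℝ} {R : (ℝ → ℝ) → (ℝ → ℝ) → Prop} {d : ℝ} {u : ℝ → ℝ → ℝ}
    (h : IsECU w b R d u) {p q : ℝ → ℝ} (hp : IsLottery w b p) (hq : IsLottery w b q)
    (hpq : ECUval w b d u p = ECUval w b d u q) : Indiff R p q :=
  ⟨(h.2.2 p q hp hq).2 hpq.ge, (h.2.2 q p hq hp).2 hpq.le⟩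

/-- A binary mixture as a ternary one with a null third component. -/
lemma mix_two_eq (a b x y : ℝ) :
    a • delta x + b • delta y = a • delta x + b • delta y + (0 : ℝ) • delta y := by
  rw [zero_smul, add_zero]

/-- Necessity of Axiom 5 (Contextual Substitutability): under an ECU representation with
threshold `d`, a lottery `p` with `p([w,d]) = α` is indifferent to the lottery obtained by
substituting each prize `x` in its support with `φ_x δ_b + (1-φ_x) δ_w`, where `φ_x` is
the appropriate substitution value. -/
theorem stmt_14 (w b : ℝ) (hwb : w < b) (R : (ℝ → ℝ) → (ℝ → ℝ) → Prop)
    (d : ℝ) (u : ℝ → ℝ → ℝ) (hECU : IsECU w b R d u)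
    (α : ℝ) (hα : α ∈ Icc (0:ℝ) 1) (p : ℝ → ℝ) (hp : IsLottery w b p)
    (hpd : prob p (Icc w d) = α) (φ : ℝ → ℝ)
    (hφ : ∀ x ∈ Function.support p, φ x ∈ Icc (0:ℝ) 1 ∧
      (x ≤ d → 0 < α →
        Indiff R (α • delta x + (1 - α) • delta b)
          ((α * φ x) • delta b + (α * (1 - φ x)) • delta w + (1 - α) • delta b)) ∧
      (d < x → α < 1 →
        Indiff R (α • delta w + (1 - α) • delta x)
          (α • delta w + ((1 - α) * φ x) • delta b + ((1 - α) * (1 - φ x)) • delta w)) ∧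
      (d = b → α = 1 →
        Indiff R (delta x) (φ x • delta b + (1 - φ x) • delta w))) :
    Indiff R p (fun y => ∑ᶠ x, p x * (φ x * delta b y + (1 - φ x) * delta w y)) := by
  have hECU' := hECU
  obtain ⟨⟨hwd, hdb⟩, ⟨hconst, -, -, -⟩, -⟩ := hECU'
  have hw : w ∈ Icc w b := ⟨le_rfl, hwb.le⟩
  have hb : b ∈ Icc w b := ⟨hwb.le, le_rfl⟩
  have hwI : (Icc w d).indicator (1 : ℝ → ℝ) w = 1 := by simp [hwd]
  have hbI : (1 - α) * (Icc w d).indicator (1 : ℝ → ℝ) b = 0 := by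
    by_cases hbd : b ≤ d
    · rw [← hpd, prob_eq_one hp (Icc_subset_Icc_right hbd), sub_self, zero_mul]
    · simp [hbd]
  have huw : ∀ π ∈ Icc (0 : ℝ) 1, u π w = u α w := fun π hπ => (hconst π hπ α hα).1
  have hub : ∀ π ∈ Icc (0 : ℝ) 1, u π b = u α b := fun π hπ => (hconst π hπ α hα).2
  have hval : ∀ a₁ a₂ a₃ x y z : ℝ, (x = w ∨ x = b) → (y = w ∨ y = b) → (z = w ∨ z = b) →
      IsLottery w b (a₁ • delta x + a₂ • delta y + a₃ • delta z) →
      ECUval w b d u (a₁ • delta x + a₂ • delta y + a₃ • delta z) =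
        a₁ * u α x + a₂ * u α y + a₃ * u α z := by
    intro a₁ a₂ a₃ x y z hx hy hz hl
    have hu : ∀ t, (t = w ∨ t = b) → u (prob (a₁ • delta x + a₂ • delta y + a₃ • delta z)
        (Icc w d)) t = u α t := by
      rintro t (rfl | rfl)
      · exact huw _ (prob_mem_Icc hl _)
      · exact hub _ (prob_mem_Icc hl _)
    rw [ECUval, finsum_mix_mul, hu x hx, hu y hy, hu z hz]
  have hutil : ∀ x ∈ Function.support p, u α x = φ x * u α b + (1 - φ x) * u α w := by
    intro x hxp
    obtain ⟨⟨hφ0, hφ1⟩, hlow, hhigh, -⟩ := hφ x hxp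
    have hx : x ∈ Icc w b := by
      by_contra h
      exact hxp (hp.2.2.1 x h)
    have hpos : 0 < p x := lt_of_le_of_ne (hp.2.1 x).1 (Ne.symm hxp)
    have hφ1' : 0 ≤ 1 - φ x := sub_nonneg.2 hφ1
    have hα1 : 0 ≤ 1 - α := sub_nonneg.2 hα.2
    rcases le_or_gt x d with hxd | hxd
    · have hα0 : 0 < α := hpd ▸ hpos.trans_le (le_prob hp ⟨hx.1, hxd⟩)
      have hind := hlow hxd hα0
      rw [mix_two_eq] at hind
      have hl := isLottery_mix hα.1 hα1 le_rfl (by ring) hx hb hb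
      have hr := isLottery_mix (mul_nonneg hα.1 hφ0) (mul_nonneg hα.1 hφ1') hα1
        (by ring) hb hw hb
      have hV := hECU.ECUval_eq hl hr hind
      have hxI : (Icc w d).indicator (1 : ℝ → ℝ) x = 1 := by simp [hx.1, hxd]
      rw [ECUval_mix u (π := α) (by rw [hxI, hbI]; ring),
        hval _ _ _ _ _ _ (.inr rfl) (.inl rfl) (.inr rfl) hr] at hV
      exact mul_left_cancel₀ hα0.ne' (by linarith)
    · have hα1' : 0 < 1 - α := by
        rw [← hpd]
        linarith [prob_add_prob_compl hp (Icc w d),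
          le_prob hp (S := (Icc w d)ᶜ) fun h => hxd.not_ge h.2]
      have hind := hhigh hxd (sub_pos.1 hα1')
      rw [mix_two_eq] at hind
      have hl := isLottery_mix hα.1 hα1 le_rfl (by ring) hw hx hx
      have hr := isLottery_mix hα.1 (mul_nonneg hα1 hφ0) (mul_nonneg hα1 hφ1')
        (by ring) hw hb hw
      have hV := hECU.ECUval_eq hl hr hind
      have hxI : (Icc w d).indicator (1 : ℝ → ℝ) x = 0 := by simp [hxd]
      rw [ECUval_mix u (π := α) (by rw [hxI, hwI]; ring),
        hval _ _ _ _ _ _ (.inl rfl) (.inr rfl) (.inl rfl) hr] at hV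
      exact mul_left_cancel₀ hα1'.ne' (by linarith)
  have hexp : ∀ A B : ℝ, ∑ᶠ x, p x * (φ x * A + (1 - φ x) * B) =
      (∑ᶠ x, p x * φ x) * A + (1 - ∑ᶠ x, p x * φ x) * B := by
    intro A B
    have hfin : (Function.support fun x => p x * φ x).Finite :=
      hp.1.subset (Function.support_mul_subset_left p φ)
    have hsplit : ∀ x, p x * (φ x * A + (1 - φ x) * B) =
        p x * φ x * (A - B) + p x * B := fun x => by ring
    simp only [hsplit]
    rw [finsum_add_distrib (hfin.subset (Function.support_mul_subset_left _ _))
      (hp.1.subset (Function.support_mul_subset_left _ _)), ← finsum_mul, ← finsum_mul,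
      hp.2.2.2]
    ring
  have hq : (fun y => ∑ᶠ x, p x * (φ x * delta b y + (1 - φ x) * delta w y)) =
      (∑ᶠ x, p x * φ x) • delta b + (1 - ∑ᶠ x, p x * φ x) • delta w + (0 : ℝ) • delta w := by
    funext y
    simp [hexp]
  have hterm : ∀ x, 0 ≤ p x * φ x ∧ p x * φ x ≤ p x := by
    intro x
    by_cases hx : p x = 0
    · simp [hx]
    · have hφx := (hφ x hx).1
      exact ⟨mul_nonneg (hp.2.1 x).1 hφx.1, mul_le_of_le_one_right (hp.2.1 x).1 hφx.2⟩
  have hle : ∑ᶠ x, p x * φ x ≤ 1 := by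
    rw [← hp.2.2.2]
    exact finsum_le_finsum' (hp.1.subset (Function.support_mul_subset_left p φ)) hp.1
      fun x => (hterm x).2
  have hlq := isLottery_mix (finsum_nonneg fun x => (hterm x).1) (sub_nonneg.2 hle) le_rfl
    (by ring) hb hw hw
  rw [hq]
  refine hECU.indiff hp hlq ?_
  rw [hval _ _ _ _ _ _ (.inr rfl) (.inl rfl) (.inl rfl) hlq, zero_mul, add_zero, ← hexp,
    ECUval, hpd]
  refine finsum_congr fun x => ?_
  by_cases hx : p x = 0
  · simp [hx]
  · rw [hutil x hx]
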